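/- arXiv:1612.07881 — 2 statements merged into one kernel-verified Lean document; each statement's English description precedes it below -/
import Mathlib

section
/- Let A be a finite alphabet with d letters and let X ⊆ A* be a finite complete synchronizing prefix code all of whose words have length at most n (n ≥ 1). Let B be a finite alphabet with d+1 letters and let r be a positive integer such that every finite incomplete set Y ⊆ B* whose words all have length at most n has an incompletable word of length at most r. Then there exists a word w ∈ X* with |w| ≤ r such that (w, ε) is a synchronizing pair of X. -/
/-- The Kleene star of a set of words: the submonoid of the free monoid generated by `X`. -/
def Kstar {A : Type*} (X : Set (List A)) : Set (List A) :=
  {w | ∃ l : List (List A), (∀ x ∈ l, x ∈ X) ∧ l.flatten = w}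

/-- `X` is complete: every word has an `X`-completion. -/
def IsCompleteSet {A : Type*} (X : Set (List A)) : Prop :=
  ∀ w : List A, ∃ r s : List A, r ++ w ++ s ∈ Kstar X

/-- `(u, v)` is a synchronizing pair of `X`. -/
def IsSyncPair {A : Type*} (X : Set (List A)) (u v : List A) : Prop :=
  u ∈ Kstar X ∧ v ∈ Kstar X ∧
    ∀ r s : List A, r ++ (u ++ v) ++ s ∈ Kstar X →
      r ++ u ∈ Kstar X ∧ v ++ s ∈ Kstar X

/-- `X` is synchronizing: it has a synchronizing pair. -/
def IsSynchronizing {A : Type*} (X : Set (List A)) : Prop :=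
  ∃ u v : List A, IsSyncPair X u v

/-- `c` is a constant of `X`. -/
def IsConstant {A : Type*} (X : Set (List A)) (c : List A) : Prop :=
  c ∈ Kstar X ∧ ∀ u₁ u₂ u₃ u₄ : List A,
    u₁ ++ c ++ u₂ ∈ Kstar X → u₃ ++ c ++ u₄ ∈ Kstar X →
      u₁ ++ c ++ u₄ ∈ Kstar X ∧ u₃ ++ c ++ u₂ ∈ Kstar X

/-- `X` is a code: every word of `X*` has a unique factorization into words of `X`. -/
def IsCode {A : Type*} (X : Set (List A)) : Prop :=
  ∀ l₁ l₂ : List (List A), (∀ x ∈ l₁, x ∈ X) → (∀ x ∈ l₂, x ∈ X) →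
    l₁.flatten = l₂.flatten → l₁ = l₂

/-- `X` is a prefix code: no word of `X` is a proper prefix of another, and `X ≠ {ε}`. -/
def IsPrefixCode {A : Type*} (X : Set (List A)) : Prop :=
  (∀ x ∈ X, ∀ y ∈ X, x <+: y → x = y) ∧ X ≠ {([] : List A)}

/-- The monoid morphism `A* → B*` generated by the map `f` on letters. -/
def mlift {A B : Type*} (f : A → List B) : List A → List B :=
  fun w => (w.map f).flatten

/-- A walk labelled by a word in the labelled graph with edges `step`. -/
def Reaches {S B : Type*} (step : S → B → S → Prop) : S → List B → S → Prop
  | p, [], q => p = q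
  | p, b :: w, q => ∃ m, step p b m ∧ Reaches step m w q

theorem Reaches.append_iff {S B : Type*} {step : S → B → S → Prop} {u v : List B} {p q : S} :
    Reaches step p (u ++ v) q ↔ ∃ m, Reaches step p u m ∧ Reaches step m v q := by
  induction u generalizing p with
  | nil => simp [Reaches]
  | cons b u ih =>
    simp only [List.cons_append, Reaches, ih]
    constructor
    · rintro ⟨m, h, m', h', h''⟩
      exact ⟨m', ⟨m, h, h'⟩, h''⟩
    · rintro ⟨m', ⟨m, h, h'⟩, h''⟩
      exact ⟨m, h, m', h', h''⟩

theorem Reaches.concat_iff {S B : Type*} {step : S → B → S → Prop} {u : List B} {b : B} {p q : S} :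
    Reaches step p (u ++ [b]) q ↔ ∃ m, Reaches step p u m ∧ step m b q := by
  simp [Reaches.append_iff, Reaches]

section Kstar

variable {A : Type*} {X : Set (List A)}

theorem nil_mem_Kstar : [] ∈ Kstar X := ⟨[], by simp, rfl⟩

theorem mem_Kstar_of_mem {x : List A} (hx : x ∈ X) : x ∈ Kstar X :=
  ⟨[x], by simpa using hx, by simp⟩

theorem append_mem_Kstar {u v : List A} (hu : u ∈ Kstar X) (hv : v ∈ Kstar X) :
    u ++ v ∈ Kstar X := by
  obtain ⟨l, hl, rfl⟩ := hu
  obtain ⟨k, hk, rfl⟩ := hv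
  refine ⟨l ++ k, fun x hx => ?_, by simp⟩
  rcases List.mem_append.1 hx with h | h
  exacts [hl x h, hk x h]

theorem eq_nil_or_append_of_mem_Kstar {w : List A} (h : w ∈ Kstar X) :
    w = [] ∨ ∃ x ∈ X, ∃ v ∈ Kstar X, w = x ++ v := by
  obtain ⟨l, hl, rfl⟩ := h
  cases l with
  | nil => simp
  | cons x l =>
    exact Or.inr ⟨x, hl x (by simp), l.flatten, ⟨l, fun y hy => hl y (by simp [hy]), rfl⟩, by simp⟩

theorem IsPrefixCode.nil_notMem (hX : IsPrefixCode X) : [] ∉ X := by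
  intro h
  refine hX.2 (Set.eq_singleton_iff_unique_mem.2 ⟨h, fun y hy => ?_⟩)
  exact (hX.1 _ h y hy (List.nil_prefix)).symm

/-- The submonoid generated by a prefix code is left unitary. -/
theorem IsPrefixCode.mem_Kstar_of_append (hX : IsPrefixCode X) {u v : List A}
    (hu : u ∈ Kstar X) (huv : u ++ v ∈ Kstar X) : v ∈ Kstar X := by
  obtain ⟨l, hl, rfl⟩ := hu
  induction l with
  | nil => simpa using huv
  | cons x l ih =>
    have hx : x ∈ X := hl x (by simp)
    refine ih (fun y hy => hl y (by simp [hy])) ?_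
    rcases eq_nil_or_append_of_mem_Kstar huv with h | ⟨y, hy, t, ht, h⟩
    · simp only [List.flatten_cons, List.append_eq_nil_iff] at h
      exact absurd (h.1.1 ▸ hx) hX.nil_notMem
    · rw [List.flatten_cons, List.append_assoc] at h
      have hxy : x = y := by
        have h1 : x <+: x ++ (l.flatten ++ v) := List.prefix_append _ _
        have h2 : y <+: x ++ (l.flatten ++ v) := h ▸ List.prefix_append _ _
        rcases List.prefix_or_prefix_of_prefix h1 h2 with h3 | h3
        · exact hX.1 _ hx _ hy h3
        · exact (hX.1 _ hy _ hx h3).symm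
      subst hxy
      rwa [List.append_cancel_left h]

/-- A complete prefix code with a synchronizing pair is right complete. -/
theorem IsPrefixCode.exists_append_mem_Kstar (hX : IsPrefixCode X) (hc : IsCompleteSet X)
    (hs : IsSynchronizing X) (w : List A) : ∃ s, w ++ s ∈ Kstar X := by
  obtain ⟨u, v, -, hv, h⟩ := hs
  obtain ⟨r, s, hrs⟩ := hc (u ++ v ++ w)
  refine ⟨s, hX.mem_Kstar_of_append hv (h r (w ++ s) ?_).2⟩
  simpa using hrs

end Kstar

section PrefixAutomaton

variable {A : Type*} {X : Set (List A)}

/-- The proper prefixes of the words of `X`. -/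
def properPrefixes (X : Set (List A)) : Set (List A) :=
  {p | ∃ s, s ≠ [] ∧ p ++ s ∈ X}

open Classical in
/-- The transition function of the automaton of proper prefixes of `X`. -/
noncomputable def prefixStep (X : Set (List A)) (p : List A) (c : A) : List A :=
  if p ++ [c] ∈ X then [] else p ++ [c]

/-- The state reached from `p` by reading `w` in the automaton of proper prefixes of `X`. -/
noncomputable def prefixRun (X : Set (List A)) (p w : List A) : List A :=
  w.foldl (prefixStep X) p

theorem prefixRun_append (p u v : List A) :
    prefixRun X p (u ++ v) = prefixRun X (prefixRun X p u) v := by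
  simp [prefixRun]

theorem prefixRun_concat (p u : List A) (c : A) :
    prefixRun X p (u ++ [c]) = prefixStep X (prefixRun X p u) c := by
  simp [prefixRun]

theorem nil_mem_properPrefixes (hX : IsPrefixCode X) (hne : X.Nonempty) :
    [] ∈ properPrefixes X := by
  obtain ⟨x, hx⟩ := hne
  exact ⟨x, fun h => hX.nil_notMem (h ▸ hx), hx⟩

theorem IsPrefixCode.not_append_mem_properPrefixes (hX : IsPrefixCode X) {x t : List A}
    (hx : x ∈ X) : x ++ t ∉ properPrefixes X := by
  rintro ⟨s, hs, h⟩
  have hlen := congrArg List.length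
    (hX.1 _ hx _ h (by rw [List.append_assoc]; exact List.prefix_append _ _))
  have hpos := List.length_pos_iff.2 hs
  simp only [List.length_append] at hlen
  omega

theorem IsPrefixCode.eq_nil_of_mem_Kstar (hX : IsPrefixCode X) {p : List A}
    (hp : p ∈ properPrefixes X) (h : p ∈ Kstar X) : p = [] := by
  rcases eq_nil_or_append_of_mem_Kstar h with h | ⟨x, hx, v, -, rfl⟩
  · exact h
  · exact absurd hp (hX.not_append_mem_properPrefixes hx)

theorem mem_properPrefixes_of_append {p t : List A} (h : p ++ t ∈ properPrefixes X) :
    p ∈ properPrefixes X := by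
  obtain ⟨s, hs, h⟩ := h
  exact ⟨t ++ s, by simp [hs], by simpa using h⟩

theorem prefixStep_mem (hX : IsPrefixCode X) (hr : ∀ w, ∃ s, w ++ s ∈ Kstar X) {p : List A}
    (hp : p ∈ properPrefixes X) (c : A) : prefixStep X p c ∈ properPrefixes X := by
  unfold prefixStep
  split_ifs with h
  · exact nil_mem_properPrefixes hX ⟨_, h⟩
  · obtain ⟨s, hs⟩ := hr (p ++ [c])
    rcases eq_nil_or_append_of_mem_Kstar hs with h0 | ⟨x, hx, v, -, h0⟩
    · simp at h0
    · have h1 : p ++ [c] <+: p ++ [c] ++ s := List.prefix_append _ _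
      have h2 : x <+: p ++ [c] ++ s := h0 ▸ List.prefix_append _ _
      rcases List.prefix_or_prefix_of_prefix h1 h2 with ⟨t, ht⟩ | h3
      · refine ⟨t, ?_, ht ▸ hx⟩
        rintro rfl
        rw [List.append_nil] at ht
        exact h (ht ▸ hx)
      · rcases List.prefix_concat_iff.1 h3 with h3 | ⟨t, rfl⟩
        · exact absurd (h3 ▸ hx) h
        · exact absurd hp (hX.not_append_mem_properPrefixes hx)

theorem prefixRun_mem (hX : IsPrefixCode X) (hr : ∀ w, ∃ s, w ++ s ∈ Kstar X) {p : List A}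
    (hp : p ∈ properPrefixes X) (w : List A) : prefixRun X p w ∈ properPrefixes X := by
  induction w using List.reverseRecOn with
  | nil => exact hp
  | append_singleton w c ih => rw [prefixRun_concat]; exact prefixStep_mem hX hr ih c

theorem exists_append_prefixRun (p w : List A) :
    ∃ m ∈ Kstar X, p ++ w = m ++ prefixRun X p w := by
  induction w using List.reverseRecOn with
  | nil => exact ⟨[], nil_mem_Kstar, by simp [prefixRun]⟩
  | append_singleton w c ih =>
    obtain ⟨m, hm, h⟩ := ih
    rw [prefixRun_concat, ← List.append_assoc, h, prefixStep]
    split_ifs with hc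
    · exact ⟨m ++ (prefixRun X p w ++ [c]), append_mem_Kstar hm (mem_Kstar_of_mem hc), by simp⟩
    · exact ⟨m, hm, by simp⟩

theorem prefixRun_eq_nil_iff (hX : IsPrefixCode X) (hr : ∀ w, ∃ s, w ++ s ∈ Kstar X)
    {p : List A} (hp : p ∈ properPrefixes X) (w : List A) :
    prefixRun X p w = [] ↔ p ++ w ∈ Kstar X := by
  obtain ⟨m, hm, h⟩ := exists_append_prefixRun (X := X) p w
  constructor
  · intro h0
    rw [h, h0, List.append_nil]
    exact hm
  · intro h0
    exact hX.eq_nil_of_mem_Kstar (prefixRun_mem hX hr hp w) (hX.mem_Kstar_of_append hm (h ▸ h0))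

theorem prefixRun_nil_left (hX : IsPrefixCode X) {p : List A} (hp : p ∈ properPrefixes X) :
    prefixRun X [] p = p := by
  obtain ⟨m, hm, h⟩ := exists_append_prefixRun (X := X) [] p
  rw [List.nil_append] at h
  have : m = [] := hX.eq_nil_of_mem_Kstar (mem_properPrefixes_of_append (h ▸ hp)) hm
  rw [this, List.nil_append] at h
  exact h.symm

/-- A word sending every proper prefix of `X` to the empty word is synchronizing. -/
theorem isSyncPair_of_prefixRun_eq_nil (hX : IsPrefixCode X) (hne : X.Nonempty)
    (hr : ∀ w, ∃ s, w ++ s ∈ Kstar X) {w : List A}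
    (hw : ∀ p ∈ properPrefixes X, prefixRun X p w = []) : IsSyncPair X w [] := by
  have hnil := nil_mem_properPrefixes hX hne
  have hwK : w ∈ Kstar X := (prefixRun_eq_nil_iff hX hr hnil w).1 (hw _ hnil)
  refine ⟨hwK, nil_mem_Kstar, fun r s h => ?_⟩
  obtain ⟨m, hm, hrm⟩ := exists_append_prefixRun (X := X) [] r
  rw [List.nil_append] at hrm
  have hq := prefixRun_mem hX hr hnil r
  have hrw : r ++ w ∈ Kstar X := by
    rw [hrm, List.append_assoc]
    exact append_mem_Kstar hm ((prefixRun_eq_nil_iff hX hr hq w).1 (hw _ hq))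
  exact ⟨hrw, hX.mem_Kstar_of_append hrw (by simpa using h)⟩

end PrefixAutomaton

section MarkedAutomaton

variable {A B : Type*} {X : Set (List A)} {a : A} {z : List A} {e : B ≃ Option A}

/-- The automaton of proper prefixes of `X` extended by one extra letter, which has no transition
from the state `z` and leads from any other state `p` both to the successor of `p` under `a` and to
the initial state. -/
def markedStep (X : Set (List A)) (a : A) (z : List A) (e : B ≃ Option A)
    (p : List A) (b : B) (q : List A) : Prop :=
  match e b with
  | some c => q = prefixStep X p c
  | none => p ≠ z ∧ (q = prefixStep X p a ∨ q = [])

theorem reaches_markedStep_map {p q w : List A} :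
    Reaches (markedStep X a z e) p (w.map fun c => e.symm (some c)) q ↔ q = prefixRun X p w := by
  induction w generalizing p with
  | nil => simp [Reaches, prefixRun, eq_comm]
  | cons c w ih => simp [Reaches, markedStep, ih, prefixRun]

theorem markedStep_mem (hX : IsPrefixCode X) (hr : ∀ w, ∃ s, w ++ s ∈ Kstar X) {p q : List A}
    {b : B} (hp : p ∈ properPrefixes X) (h : markedStep X a z e p b q) :
    q ∈ properPrefixes X := by
  unfold markedStep at h
  split at h
  · exact h ▸ prefixStep_mem hX hr hp _
  · rcases h with ⟨-, rfl | rfl⟩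
    · exact prefixStep_mem hX hr hp _
    · exact mem_properPrefixes_of_append (p := []) (t := p) hp

theorem reaches_markedStep_mem (hX : IsPrefixCode X) (hr : ∀ w, ∃ s, w ++ s ∈ Kstar X)
    {p q : List A} {w : List B} (hp : p ∈ properPrefixes X)
    (h : Reaches (markedStep X a z e) p w q) : q ∈ properPrefixes X := by
  induction w generalizing p with
  | nil => exact h ▸ hp
  | cons b w ih =>
    obtain ⟨m, h1, h2⟩ := h
    exact ih (markedStep_mem hX hr hp h1) h2

theorem markedStep_eq_nil_or_length {p q : List A} {b : B} (h : markedStep X a z e p b q) :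
    q = [] ∨ q.length = p.length + 1 := by
  unfold markedStep prefixStep at h
  grind

/-- The words of length at most `n` labelling a closed walk at the initial state of the extended
automaton. -/
def markedSet (X : Set (List A)) (a : A) (z : List A) (e : B ≃ Option A) (n : ℕ) :
    Set (List B) :=
  {y | y.length ≤ n ∧ Reaches (markedStep X a z e) [] y []}

theorem reaches_of_mem_Kstar_markedSet {n : ℕ} {w : List B}
    (h : w ∈ Kstar (markedSet X a z e n)) : Reaches (markedStep X a z e) [] w [] := by
  obtain ⟨l, hl, rfl⟩ := h
  induction l with
  | nil => rfl
  | cons y l ih =>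
    exact Reaches.append_iff.2 ⟨[], (hl y (by simp)).2, ih fun x hx => hl x (by simp [hx])⟩

theorem exists_append_of_reaches (hX : IsPrefixCode X) (hne : X.Nonempty)
    (hr : ∀ w, ∃ s, w ++ s ∈ Kstar X) {n : ℕ} (hlen : ∀ w ∈ X, w.length ≤ n) {w : List B}
    {q : List A} (h : Reaches (markedStep X a z e) [] w q) :
    ∃ m y, w = m ++ y ∧ m ∈ Kstar (markedSet X a z e n) ∧
      Reaches (markedStep X a z e) [] y q ∧ y.length = q.length := by
  induction w using List.reverseRecOn generalizing q with
  | nil => exact ⟨[], [], rfl, nil_mem_Kstar, h, by rw [← (h : [] = q)]; rfl⟩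
  | append_singleton w b ih =>
    obtain ⟨p, hp, hpq⟩ := Reaches.concat_iff.1 h
    obtain ⟨m, y, rfl, hm, hy, hyl⟩ := ih hp
    have hyb := Reaches.concat_iff.2 ⟨p, hy, hpq⟩
    rcases markedStep_eq_nil_or_length hpq with rfl | hq
    · obtain ⟨s, hs, hps⟩ := reaches_markedStep_mem hX hr (nil_mem_properPrefixes hX hne) hp
      have h1 := hlen _ hps
      have h2 := List.length_pos_iff.2 hs
      have h3 : y ++ [b] ∈ markedSet X a z e n := by
        refine ⟨?_, hyb⟩
        simp only [List.length_append, List.length_singleton] at h1 ⊢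
        omega
      exact ⟨m ++ (y ++ [b]), [], by simp, append_mem_Kstar hm (mem_Kstar_of_mem h3), rfl, rfl⟩
    · exact ⟨m, y ++ [b], by simp, hm, hyb, by simp [hyl, hq]⟩

theorem mem_Kstar_markedSet_iff (hX : IsPrefixCode X) (hne : X.Nonempty)
    (hr : ∀ w, ∃ s, w ++ s ∈ Kstar X) {n : ℕ} (hlen : ∀ w ∈ X, w.length ≤ n) {w : List B} :
    w ∈ Kstar (markedSet X a z e n) ↔ Reaches (markedStep X a z e) [] w [] := by
  refine ⟨reaches_of_mem_Kstar_markedSet, fun h => ?_⟩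
  obtain ⟨m, y, rfl, hm, -, hy⟩ := exists_append_of_reaches hX hne hr hlen h
  rw [List.length_nil, List.length_eq_zero_iff] at hy
  simpa [hy] using hm

theorem finite_markedSet [Finite B] (n : ℕ) : (markedSet X a z e n).Finite :=
  (List.finite_length_le B n).subset fun _ h => h.1

theorem not_isCompleteSet_markedSet (hX : IsPrefixCode X) (hr : ∀ w, ∃ s, w ++ s ∈ Kstar X)
    (hs : IsSynchronizing X) (hz : z ∈ properPrefixes X) (n : ℕ) :
    ¬ IsCompleteSet (markedSet X a z e n) := by
  intro hcomp
  obtain ⟨u, v, hu, hv, huv⟩ := hs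
  obtain ⟨r, s, h⟩ := hcomp (((u ++ v) ++ z).map (fun c => e.symm (some c)) ++ [e.symm none])
  have h := reaches_of_mem_Kstar_markedSet h
  obtain ⟨q', h, -⟩ := Reaches.append_iff.1 h
  obtain ⟨p, hp, h⟩ := Reaches.append_iff.1 h
  obtain ⟨q, hq, h⟩ := Reaches.concat_iff.1 h
  have hnil : [] ∈ properPrefixes X := mem_properPrefixes_of_append (p := []) (t := z) hz
  have hpQ := reaches_markedStep_mem hX hr hnil hp
  have hp0 : prefixRun X p (u ++ v) = [] := by
    rw [prefixRun_eq_nil_iff hX hr hpQ]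
    obtain ⟨t, ht⟩ := hr (p ++ (u ++ v))
    rw [← List.append_assoc]
    exact append_mem_Kstar (huv p t ht).1 hv
  rw [reaches_markedStep_map, prefixRun_append, hp0, prefixRun_nil_left hX hz] at hq
  simp only [markedStep, Equiv.apply_symm_apply] at h
  exact h.1 hq

/-- If replacing the extra letter by `a` turns no prefix of `w` into a synchronizing word, then
every walk of the resulting word in the automaton of proper prefixes can be imitated by a walk
of `w` with the same end in the extended automaton. -/
theorem exists_reaches_prefixRun (hza : z ++ [a] ∈ X) {w : List B}
    (hw : ∀ v, v <+: w →
      ∃ p ∈ properPrefixes X, prefixRun X p (v.map fun b => (e b).getD a) ≠ [])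
    {p : List A} (hp : p ∈ properPrefixes X) :
    ∃ q ∈ properPrefixes X,
      Reaches (markedStep X a z e) q w (prefixRun X p (w.map fun b => (e b).getD a)) := by
  induction w using List.reverseRecOn generalizing p with
  | nil => exact ⟨p, hp, rfl⟩
  | append_singleton w b ih =>
    have ih := @ih fun v hv => hw v (hv.trans (List.prefix_append _ _))
    have hzn : prefixStep X z a = [] := by simp [prefixStep, hza]
    simp only [List.map_append, List.map_singleton, prefixRun_concat, Reaches.concat_iff]
    cases hb : e b with
    | some c =>
      obtain ⟨q, hq, h⟩ := ih hp
      exact ⟨q, hq, _, h, by simp [markedStep, hb]⟩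
    | none =>
      by_cases hpz : prefixRun X p (w.map fun b => (e b).getD a) = z
      · obtain ⟨p', hp', h'⟩ := hw (w ++ [b]) List.prefix_rfl
        obtain ⟨q, hq, h⟩ := ih hp'
        refine ⟨q, hq, _, h, ?_⟩
        simp only [List.map_append, List.map_singleton, prefixRun_concat, hb,
          Option.getD_none] at h'
        simp only [markedStep, hb, Option.getD_none, hpz, hzn, or_true, and_true]
        rintro h0
        exact h' (by rw [h0, hzn])
      · obtain ⟨q, hq, h⟩ := ih hp
        exact ⟨q, hq, _, h, by simp [markedStep, hb, hpz]⟩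

/-- An incompletable word of the marked set has a prefix that becomes synchronizing when the extra
letter is replaced by `a`. -/
theorem exists_prefixRun_eq_nil_of_incompletable (hX : IsPrefixCode X)
    (hr : ∀ w, ∃ s, w ++ s ∈ Kstar X) {n : ℕ} (hlen : ∀ w ∈ X, w.length ≤ n)
    (hza : z ++ [a] ∈ X) {w : List B}
    (hw : ∀ r s : List B, r ++ w ++ s ∉ Kstar (markedSet X a z e n)) :
    ∃ v, v <+: w ∧
      ∀ p ∈ properPrefixes X, prefixRun X p (v.map fun b => (e b).getD a) = [] := by
  by_contra! hcon
  have hne : X.Nonempty := ⟨_, hza⟩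
  have hnil := nil_mem_properPrefixes hX hne
  obtain ⟨p, hp, h⟩ := exists_reaches_prefixRun hza hcon hnil
  have hq := prefixRun_mem hX hr hnil (w.map fun b => (e b).getD a)
  obtain ⟨s, -, hs⟩ := id hq
  refine hw (p.map fun c => e.symm (some c)) (s.map fun c => e.symm (some c)) ?_
  rw [mem_Kstar_markedSet_iff hX hne hr hlen, Reaches.append_iff]
  refine ⟨_, Reaches.append_iff.2 ⟨p, ?_, h⟩, ?_⟩
  · rw [reaches_markedStep_map, prefixRun_nil_left hX hp]
  · rw [reaches_markedStep_map, eq_comm, prefixRun_eq_nil_iff hX hr hq]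
    exact mem_Kstar_of_mem hs

end MarkedAutomaton

/-- Prefix-code version of the main result: the complete synchronizing prefix code `X` has a
synchronizing pair `(w, ε)` with `|w| ≤ r`. -/
theorem syncPair_length_le_prefix {A B : Type*} [Fintype A] [Fintype B] (d n r : ℕ)
    (hA : Fintype.card A = d) (hB : Fintype.card B = d + 1) (hn : 1 ≤ n) (hr : 0 < r)
    (X : Set (List A)) (hXfin : X.Finite) (hXlen : ∀ w ∈ X, w.length ≤ n)
    (hXpref : IsPrefixCode X) (hXcomp : IsCompleteSet X) (hXsync : IsSynchronizing X)
    (hR : ∀ Y : Set (List B), Y.Finite → (∀ w ∈ Y, w.length ≤ n) → ¬ IsCompleteSet Y →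
      ∃ w : List B, (∀ p s : List B, p ++ w ++ s ∉ Kstar Y) ∧ w.length ≤ r) :
    ∃ w : List A, w ∈ Kstar X ∧ w.length ≤ r ∧ IsSyncPair X w ([] : List A) := by
  rcases X.eq_empty_or_nonempty with rfl | ⟨x, hx⟩
  · refine ⟨[], nil_mem_Kstar, by simp, nil_mem_Kstar, nil_mem_Kstar, fun p s h => ?_⟩
    rcases eq_nil_or_append_of_mem_Kstar h with h | ⟨x, hx, -⟩
    · simp only [List.append_nil, List.append_eq_nil_iff] at h
      simp [h, nil_mem_Kstar]
    · exact absurd hx (Set.notMem_empty x)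
  · have hright := hXpref.exists_append_mem_Kstar hXcomp hXsync
    obtain rfl | ⟨z, a, rfl⟩ := x.eq_nil_or_concat'
    · exact absurd hx hXpref.nil_notMem
    have e : B ≃ Option A := Fintype.equivOfCardEq (by rw [Fintype.card_option, hA, hB])
    obtain ⟨w, hw, hwr⟩ := hR (markedSet X a z e n) (finite_markedSet n) (fun _ h => h.1)
      (not_isCompleteSet_markedSet hXpref hright hXsync ⟨[a], by simp, hx⟩ n)
    obtain ⟨v, hvw, hv⟩ := exists_prefixRun_eq_nil_of_incompletable hXpref hright hXlen hx hw
    have hsync := isSyncPair_of_prefixRun_eq_nil hXpref ⟨_, hx⟩ hright hv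
    exact ⟨_, hsync.1, by simpa using hvw.length_le.trans hwr, hsync⟩
end

section
/- Let A be a finite alphabet with d ≥ 2 letters, let B be a binary alphabet, and let X ⊆ A* be a finite incomplete set all of whose words have length at most n (n ≥ 1). Let r be a positive integer such that every finite incomplete set Y ⊆ B* whose words all have length at most ⌈log₂ d⌉·n has an incompletable word of length at most r. Then X has an incompletable word of length at most ⌈r / ⌊log₂ d⌋⌉. -/
theorem mlift_nil {A B : Type*} (f : A → List B) : mlift f [] = [] := rfl

theorem mlift_cons {A B : Type*} (f : A → List B) (a : A) (w : List A) :
    mlift f (a :: w) = f a ++ mlift f w := by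
  simp [mlift]

theorem mlift_append {A B : Type*} (f : A → List B) (u v : List A) :
    mlift f (u ++ v) = mlift f u ++ mlift f v := by
  simp [mlift]

theorem length_mlift_le {A B : Type*} {f : A → List B} {K : ℕ} (hf : ∀ a, (f a).length ≤ K)
    (w : List A) : (mlift f w).length ≤ K * w.length := by
  induction w with
  | nil => simp [mlift_nil]
  | cons a w ih =>
    have := hf a
    simp only [mlift_cons, List.length_append, List.length_cons, mul_add]
    omega

theorem mlift_flatten {A B : Type*} (f : A → List B) (l : List (List A)) :
    mlift f l.flatten = (l.map (mlift f)).flatten := by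
  induction l with
  | nil => rfl
  | cons x l ih => simp [mlift_append, ih]

theorem mem_Kstar_image_mlift {A B : Type*} {f : A → List B} {X : Set (List A)} {w : List B} :
    w ∈ Kstar (mlift f '' X) ↔ ∃ x ∈ Kstar X, mlift f x = w := by
  constructor
  · rintro ⟨l, hl, rfl⟩
    induction l with
    | nil => exact ⟨[], ⟨[], by simp, rfl⟩, rfl⟩
    | cons y l ih =>
      obtain ⟨x, hx, rfl⟩ := hl y (by simp)
      obtain ⟨_, ⟨m, hm, rfl⟩, h⟩ := ih fun z hz => hl z (by simp [hz])
      refine ⟨(x :: m).flatten, ⟨x :: m, ?_, rfl⟩, by simp [mlift_append, h]⟩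
      intro z hz
      rcases List.mem_cons.1 hz with rfl | hz
      exacts [hx, hm z hz]
  · rintro ⟨_, ⟨l, hl, rfl⟩, rfl⟩
    refine ⟨l.map (mlift f), ?_, (mlift_flatten f l).symm⟩
    intro y hy
    obtain ⟨x, hx, rfl⟩ := List.mem_map.1 hy
    exact ⟨x, hl x hx, rfl⟩

/-- A morphism whose letter images form a prefix code reflects the prefix order. -/
theorem prefix_of_mlift_prefix {A B : Type*} {f : A → List B} (hne : ∀ a, f a ≠ [])
    (hpre : ∀ a b, f a <+: f b → a = b) {u v : List A} (h : mlift f u <+: mlift f v) :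
    u <+: v := by
  induction u generalizing v with
  | nil => exact List.nil_prefix
  | cons a u ih =>
    cases v with
    | nil =>
      rw [mlift_cons, mlift_nil, List.prefix_nil, List.append_eq_nil_iff] at h
      exact absurd h.1 (hne a)
    | cons b v =>
      rw [mlift_cons, mlift_cons] at h
      have hab : a = b := by
        rcases List.prefix_or_prefix_of_prefix ((List.prefix_append _ _).trans h)
          (List.prefix_append (f b) (mlift f v)) with h' | h'
        exacts [hpre a b h', (hpre b a h').symm]
      subst hab
      rw [List.prefix_append_right_inj] at h
      exact (List.prefix_cons_inj a).2 (ih h)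

/-- If the letter images form a right complete code, every word extends to an image. -/
theorem exists_prefix_mlift {A B : Type*} {f : A → List B} {k : ℕ} (hk : 1 ≤ k)
    (hlen : ∀ a, k ≤ (f a).length) (hcomp : ∀ w, ∃ a, w <+: f a ∨ f a <+: w) (w : List B) :
    ∃ u : List A, w <+: mlift f u ∧ k * u.length < w.length + k := by
  induction hm : w.length using Nat.strong_induction_on generalizing w with
  | _ m ih =>
    by_cases hw : w = []
    · exact ⟨[], by simp [hw], by simp; omega⟩
    have hpos := List.length_pos_iff.2 hw
    obtain ⟨a, h | ⟨v, rfl⟩⟩ := hcomp w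
    · exact ⟨[a], by simpa [mlift_cons, mlift_nil] using h, by simp; omega⟩
    · have := hlen a
      rw [List.length_append] at hm
      obtain ⟨u, hu, hul⟩ := ih v.length (by omega) v rfl
      refine ⟨a :: u, ?_, ?_⟩
      · rw [mlift_cons]
        exact (List.prefix_append_right_inj _).2 hu
      · rw [List.length_cons, mul_add]
        omega

theorem exists_eq_mlift_append {A B : Type*} {f : A → List B} {K : ℕ} (hne : ∀ a, f a ≠ [])
    (hlen : ∀ a, (f a).length ≤ K) (hcomp : ∀ w, ∃ a, w <+: f a ∨ f a <+: w) (w : List B) :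
    ∃ (u : List A) (t : List B), w = mlift f u ++ t ∧ t.length ≤ K := by
  induction hm : w.length using Nat.strong_induction_on generalizing w with
  | _ m ih =>
    obtain ⟨a, h | ⟨v, rfl⟩⟩ := hcomp w
    · exact ⟨[], w, rfl, h.length_le.trans (hlen a)⟩
    · have := List.length_pos_iff.2 (hne a)
      rw [List.length_append] at hm
      obtain ⟨u, t, rfl, ht⟩ := ih v.length (by omega) v rfl
      exact ⟨a :: u, t, by simp [mlift_cons], ht⟩

/-- For finitely many left contexts `t`, a single word contains `mlift f u` at a position
that is aligned with the images of letters, whichever context is put in front of it. -/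
theorem exists_word_aligned {A B : Type*} {f : A → List B}
    (hext : ∀ w, ∃ v : List A, w <+: mlift f v) (u : List A) {T : Set (List B)}
    (hT : T.Finite) :
    ∃ w : List B, ∀ t ∈ T, ∃ (x y : List B) (a : List A),
      w = x ++ mlift f u ++ y ∧ t ++ x = mlift f a := by
  induction T, hT using Set.Finite.induction_on with
  | empty => exact ⟨[], by simp⟩
  | @insert t T _ _ ih =>
    obtain ⟨w, hw⟩ := ih
    obtain ⟨a, v, hv⟩ := hext (t ++ w)
    refine ⟨w ++ v ++ mlift f u, ?_⟩
    intro t' ht'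
    rcases Set.mem_insert_iff.1 ht' with rfl | ht'
    · exact ⟨w ++ v, [], a, by simp, by simpa using hv⟩
    · obtain ⟨x, y, b, rfl, hb⟩ := hw t' ht'
      exact ⟨x, y ++ v ++ mlift f u, b, by simp, hb⟩

theorem not_isCompleteSet_image_mlift {A B : Type*} [Finite B] {f : A → List B} {K : ℕ}
    (hne : ∀ a, f a ≠ []) (hlen : ∀ a, (f a).length ≤ K)
    (hpre : ∀ a b, f a <+: f b → a = b) (hcomp : ∀ w, ∃ a, w <+: f a ∨ f a <+: w)
    {X : Set (List A)} (hX : ¬ IsCompleteSet X) : ¬ IsCompleteSet (mlift f '' X) := by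
  intro hY
  simp only [IsCompleteSet, not_forall, not_exists] at hX
  obtain ⟨u, hu⟩ := hX
  have hext (w : List B) : ∃ v : List A, w <+: mlift f v :=
    (exists_prefix_mlift le_rfl (fun a => List.length_pos_iff.2 (hne a)) hcomp w).imp
      fun _ h => h.1
  obtain ⟨w, hw⟩ := exists_word_aligned hext u (List.finite_length_le B K)
  obtain ⟨p, s, hps⟩ := hY w
  obtain ⟨x, hx, hxe⟩ := mem_Kstar_image_mlift.1 hps
  obtain ⟨a, t, rfl, ht⟩ := exists_eq_mlift_append hne hlen hcomp p
  obtain ⟨y, z, b, rfl, hb⟩ := hw t ht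
  have h : mlift f (a ++ b ++ u) <+: mlift f x :=
    ⟨z ++ s, by rw [hxe, mlift_append, mlift_append, ← hb]; simp⟩
  obtain ⟨v, rfl⟩ := prefix_of_mlift_prefix hne hpre h
  exact hu _ _ hx

/-- A nonempty finite set of size `m` is encoded by a maximal binary prefix code whose words
have lengths between `⌊log₂ m⌋` and `⌈log₂ m⌉`. -/
theorem exists_balanced_prefix_code {A B : Type*} {b₀ b₁ : B} (hb : b₀ ≠ b₁)
    (hB : ∀ b, b = b₀ ∨ b = b₁) (S : Finset A) (hS : S.Nonempty) :
    ∃ f : A → List B,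
      (∀ a ∈ S, Nat.log 2 S.card ≤ (f a).length ∧ (f a).length ≤ Nat.clog 2 S.card) ∧
      (∀ a ∈ S, ∀ b ∈ S, f a <+: f b → a = b) ∧
      ∀ w, ∃ a ∈ S, w <+: f a ∨ f a <+: w := by
  classical
  induction hm : S.card using Nat.strong_induction_on generalizing S with
  | _ m ih =>
    have hpos := hS.card_pos
    rcases Nat.lt_or_ge m 2 with h2 | h2
    · obtain rfl : m = 1 := by omega
      obtain ⟨c, rfl⟩ := Finset.card_eq_one.1 hm
      exact ⟨fun _ => [], by simp, by simp, by simp⟩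
    obtain ⟨T, hTS, hT⟩ := Finset.exists_subset_card_eq (s := S) (n := m / 2) (by omega)
    have hU : (S \ T).card = (m + 1) / 2 := by
      rw [Finset.card_sdiff_of_subset hTS]
      omega
    obtain ⟨f, hfl, hfp, hfc⟩ := ih (m / 2) (by omega) T (Finset.card_pos.1 (by omega)) hT
    obtain ⟨g, hgl, hgp, hgc⟩ :=
      ih ((m + 1) / 2) (by omega) (S \ T) (Finset.card_pos.1 (by omega)) hU
    have hlog : Nat.log 2 m = Nat.log 2 (m / 2) + 1 := Nat.log_of_one_lt_of_le (by omega) h2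
    have hclog : Nat.clog 2 m = Nat.clog 2 ((m + 1) / 2) + 1 := Nat.clog_of_two_le (by omega) h2
    have hlog' : Nat.log 2 (m / 2) ≤ Nat.log 2 ((m + 1) / 2) := Nat.log_mono_right (by omega)
    have hclog' : Nat.clog 2 (m / 2) ≤ Nat.clog 2 ((m + 1) / 2) :=
      Nat.clog_mono_right 2 (by omega)
    refine ⟨fun a => if a ∈ T then b₀ :: f a else b₁ :: g a, ?_, ?_, ?_⟩
    · intro a ha
      by_cases haT : a ∈ T
      · have := hfl a haT
        simp only [haT, if_true, List.length_cons]
        omega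
      · have := hgl a (by simp [ha, haT])
        simp only [haT, if_false, List.length_cons]
        omega
    · intro a ha b hb' h
      by_cases haT : a ∈ T <;> by_cases hbT : b ∈ T <;>
        simp only [haT, hbT, if_true, if_false, List.cons_prefix_cons] at h
      · exact hfp a haT b hbT h.2
      · exact absurd h.1 hb
      · exact absurd h.1.symm hb
      · exact hgp a (by simp [ha, haT]) b (by simp [hb', hbT]) h.2
    · rintro (_ | ⟨c, w⟩)
      · obtain ⟨a, ha⟩ := hS
        exact ⟨a, ha, Or.inl List.nil_prefix⟩
      rcases hB c with rfl | rfl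
      · obtain ⟨a, ha, h⟩ := hfc w
        exact ⟨a, hTS ha, by simpa [ha, List.cons_prefix_cons] using h⟩
      · obtain ⟨a, ha, h⟩ := hgc w
        obtain ⟨haS, haT⟩ := Finset.mem_sdiff.1 ha
        exact ⟨a, haS, by simpa [haT, List.cons_prefix_cons] using h⟩


/-- Reduction to the binary case for incompletable words: if every finite incomplete set over
a binary alphabet with words of length at most `⌈log₂ d⌉·n` has an incompletable word of length
at most `r`, then a finite incomplete set over a `d`-letter alphabet with words of length at
most `n` has an incompletable word of length at most `⌈r / ⌊log₂ d⌋⌉`. -/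
theorem incompletable_reduction_to_binary {A B : Type*} [Fintype A] [Fintype B] (d n r : ℕ)
    (hA : Fintype.card A = d) (hd : 2 ≤ d) (hB : Fintype.card B = 2) (hn : 1 ≤ n) (hr : 0 < r)
    (X : Set (List A)) (hXfin : X.Finite) (hXlen : ∀ w ∈ X, w.length ≤ n)
    (hXinc : ¬ IsCompleteSet X)
    (hR : ∀ Y : Set (List B), Y.Finite → (∀ w ∈ Y, w.length ≤ Nat.clog 2 d * n) →
      ¬ IsCompleteSet Y →
      ∃ w : List B, (∀ p s : List B, p ++ w ++ s ∉ Kstar Y) ∧ w.length ≤ r) :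
    ∃ w : List A, (∀ p s : List A, p ++ w ++ s ∉ Kstar X) ∧
      (w.length : ℤ) ≤ ⌈(r : ℚ) / (Nat.log 2 d : ℚ)⌉ := by
  classical
  obtain ⟨b₀, b₁, hb, hu⟩ := Finset.card_eq_two.1 (Finset.card_univ.trans hB)
  have hB' (b : B) : b = b₀ ∨ b = b₁ := by
    simpa [hu] using Finset.mem_univ b
  have hne : (Finset.univ : Finset A).Nonempty :=
    Finset.card_pos.1 (by rw [Finset.card_univ, hA]; omega)
  obtain ⟨f, hlen, hpre, hcomp⟩ := exists_balanced_prefix_code hb hB' Finset.univ hne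
  simp only [Finset.mem_univ, forall_const, true_and, Finset.card_univ, hA] at hlen hpre hcomp
  have hk : 1 ≤ Nat.log 2 d := Nat.log_pos (by omega) hd
  have hfne (a : A) : f a ≠ [] := List.length_pos_iff.1 (hk.trans (hlen a).1)
  obtain ⟨w, hw, hwr⟩ := hR (mlift f '' X) (hXfin.image _)
    (by
      rintro _ ⟨x, hx, rfl⟩
      exact (length_mlift_le (fun a => (hlen a).2) x).trans
        (Nat.mul_le_mul_left _ (hXlen x hx)))
    (not_isCompleteSet_image_mlift hfne (fun a => (hlen a).2) hpre hcomp hXinc)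
  obtain ⟨v, ⟨z, hz⟩, hvl⟩ := exists_prefix_mlift hk (fun a => (hlen a).1) hcomp w
  refine ⟨v, fun p s hps => hw (mlift f p) (z ++ mlift f s) ?_, ?_⟩
  · exact mem_Kstar_image_mlift.2 ⟨_, hps, by simp [mlift_append, ← hz]⟩
  · have hkq : (0 : ℚ) < Nat.log 2 d := by exact_mod_cast hk
    have h : (Nat.log 2 d : ℚ) * v.length < r + Nat.log 2 d := by
      exact_mod_cast hvl.trans_le (Nat.add_le_add_right hwr _)
    rw [← Int.sub_one_lt_iff, Int.lt_ceil, lt_div_iff₀ hkq]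
    push_cast
    linarith
end
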